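/- arXiv:2506.04530 — 3 statements merged into one kernel-verified Lean document; each statement's English description precedes it below -/
import Mathlib

section
/- Assume N P_𝒞 ≠ 0 for every nonzero N ∈ 𝒩. If (𝒞, Φ) is a quantum 𝒩-correcting code, then there exists a 𝒞-decoding inner product on 𝒩 (i.e., an inner product φ on 𝒩 with η N* M ρ = φ(N,M) η ρ for all states η, ρ supported in 𝒞 and all N, M ∈ 𝒩). -/
open scoped InnerProductSpace ComplexConjugate ComplexOrder
open LinearMap Submodule

noncomputable section

variable {H : Type} [NormedAddCommGroup H] [InnerProductSpace ℂ H] [FiniteDimensional ℂ H]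

/-- The support of an operator. -/
def supp (T : H →ₗ[ℂ] H) : Submodule ℂ H := (LinearMap.ker T)ᗮ

/-- The orthogonal projection onto a subspace, as an operator on `H`. -/
def projOf (C : Submodule ℂ H) : H →ₗ[ℂ] H :=
  C.subtype ∘ₗ (orthogonalProjection C).toLinearMap

/-- A state supported in `C`. -/
def IsStateOn (C : Submodule ℂ H) (ρ : H →ₗ[ℂ] H) : Prop :=
  LinearMap.adjoint ρ = ρ ∧ (∀ x : H, 0 ≤ ⟪x, ρ x⟫_ℂ) ∧
    LinearMap.trace ℂ H ρ = 1 ∧ supp ρ ≤ C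

/-- A quantum channel: a map given by Kraus operators `K_j` with `Σ K_j* K_j = I`. -/
def IsQuantumChannel (Φ : (H →ₗ[ℂ] H) → (H →ₗ[ℂ] H)) : Prop :=
  ∃ (n : ℕ) (K : Fin n → (H →ₗ[ℂ] H)),
    (∑ j, LinearMap.adjoint (K j) ∘ₗ K j) = LinearMap.id ∧
    ∀ ρ, Φ ρ = ∑ j, K j ∘ₗ ρ ∘ₗ LinearMap.adjoint (K j)

/-- `Φ` is a quantum channel decoding the code `C` against the noise `𝒩`:
`Φ (N ρ N*) = tr (ρ N* N) ρ` for every state `ρ` supported in `C` and `N ∈ 𝒩`. -/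
def Decodes (𝒩 : Submodule ℂ (H →ₗ[ℂ] H)) (C : Submodule ℂ H)
    (Φ : (H →ₗ[ℂ] H) → (H →ₗ[ℂ] H)) : Prop :=
  IsQuantumChannel Φ ∧ ∀ ρ : H →ₗ[ℂ] H, IsStateOn C ρ → ∀ N ∈ 𝒩,
    Φ (N ∘ₗ ρ ∘ₗ LinearMap.adjoint N) =
      LinearMap.trace ℂ H (ρ ∘ₗ LinearMap.adjoint N ∘ₗ N) • ρ

/-- A sesquilinear form (antilinear in the first argument). -/
def IsSesq {M : Type} [AddCommGroup M] [Module ℂ M] (φ : M → M → ℂ) : Prop :=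
  (∀ a b c, φ (a + b) c = φ a c + φ b c) ∧
  (∀ (z : ℂ) (a b), φ (z • a) b = conj z * φ a b) ∧
  (∀ a b c, φ a (b + c) = φ a b + φ a c) ∧
  (∀ (z : ℂ) (a b), φ a (z • b) = z * φ a b)

/-- An inner product: a positive-definite Hermitian sesquilinear form. -/
def IsInnerProd {M : Type} [AddCommGroup M] [Module ℂ M] (φ : M → M → ℂ) : Prop :=
  IsSesq φ ∧ (∀ a b, conj (φ a b) = φ b a) ∧ (∀ a, a ≠ 0 → 0 < φ a a)

/-- `φ` is the `C`-decoding inner product on `𝒩`. -/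
def IsDecodingInner (C : Submodule ℂ H) (𝒩 : Submodule ℂ (H →ₗ[ℂ] H))
    (φ : 𝒩 → 𝒩 → ℂ) : Prop :=
  IsInnerProd φ ∧ ∀ η ρ : H →ₗ[ℂ] H, IsStateOn C η → IsStateOn C ρ → ∀ n m : 𝒩,
    η ∘ₗ (LinearMap.adjoint (n : H →ₗ[ℂ] H) ∘ₗ (m : H →ₗ[ℂ] H)) ∘ₗ ρ =
      φ n m • (η ∘ₗ ρ)

lemma eigen_aux (C : Submodule ℂ H) (f : H →ₗ[ℂ] H)
    (h : ∀ u ∈ C, ∃ c : ℂ, f u = c • u) : ∃ c : ℂ, ∀ u ∈ C, f u = c • u := by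
  by_cases hC : ∃ e ∈ C, e ≠ 0
  · obtain ⟨e, he, he0⟩ := hC
    obtain ⟨c, hc⟩ := h e he
    refine ⟨c, fun u hu => ?_⟩
    obtain ⟨b, hb⟩ := h u hu
    obtain ⟨d, hd⟩ := h (e + u) (C.add_mem he hu)
    by_cases hl : ∃ t : ℂ, u = t • e
    · obtain ⟨t, rfl⟩ := hl
      rw [map_smul, hc, smul_comm]
    · rw [map_add, hc, hb] at hd
      have h1 : (b - d) • u = (d - c) • e := by
        rw [sub_smul, sub_smul, sub_eq_sub_iff_add_eq_add, ← smul_add, ← hd, add_comm]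
      have h2 : b - d = 0 := by
        by_contra hbd
        exact hl ⟨(b - d)⁻¹ * (d - c), by rw [mul_smul, ← h1, inv_smul_smul₀ hbd]⟩
      rw [h2, zero_smul] at h1
      have h3 : d - c = 0 := (smul_eq_zero.mp h1.symm).resolve_right he0
      rw [hb, sub_eq_zero.mp h2, sub_eq_zero.mp h3]
  · push Not at hC
    exact ⟨0, fun u hu => by simp [hC u hu]⟩

lemma state_range (C : Submodule ℂ H) (ρ : H →ₗ[ℂ] H) (h : IsStateOn C ρ) (x : H) : ρ x ∈ C := by
  apply h.2.2.2
  intro y hy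
  rw [← h.1, LinearMap.adjoint_inner_right, LinearMap.mem_ker.mp hy, inner_zero_left]

lemma state_unit (C : Submodule ℂ H) (u : H) (hu : u ∈ C) (h1 : ‖u‖ = 1) :
    IsStateOn C (InnerProductSpace.rankOne ℂ u u).toLinearMap := by
  refine ⟨?_, ?_, ?_, ?_⟩
  · symm
    rw [LinearMap.eq_adjoint_iff]
    intro x y
    simp [inner_smul_left, inner_smul_right, mul_comm]
  · intro x
    simp only [ContinuousLinearMap.coe_coe, InnerProductSpace.rankOne_apply, inner_smul_right]
    rw [← inner_conj_symm u x, mul_comm, Complex.mul_conj]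
    exact_mod_cast Complex.normSq_nonneg _
  · rw [InnerProductSpace.trace_rankOne, inner_self_eq_norm_sq_to_K, h1]
    simp
  · rw [supp, ← Submodule.orthogonal_orthogonal C]
    apply Submodule.orthogonal_le
    intro x hx
    rw [LinearMap.mem_ker]
    show ⟪u, x⟫_ℂ • u = 0
    rw [(Submodule.mem_orthogonal C x).mp hx u hu, zero_smul]

lemma kraus_eigen (C : Submodule ℂ H) (n : ℕ) (K : Fin n → (H →ₗ[ℂ] H)) (N : H →ₗ[ℂ] H)
    (h : ∀ ρ : H →ₗ[ℂ] H, IsStateOn C ρ → ∃ t : ℂ,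
      ∑ j, K j ∘ₗ (N ∘ₗ ρ ∘ₗ LinearMap.adjoint N) ∘ₗ LinearMap.adjoint (K j) = t • ρ)
    (j : Fin n) : ∃ c : ℂ, ∀ u ∈ C, K j (N u) = c • u := by
  have key : ∀ u ∈ C, ‖u‖ = 1 → ∃ c : ℂ, K j (N u) = c • u := by
    intro u hu h1
    obtain ⟨t, ht⟩ := h _ (state_unit C u hu h1)
    have hperp : ∀ w, ⟪u, w⟫_ℂ = 0 → ⟪w, K j (N u)⟫_ℂ = 0 := by
      intro w hw
      have h2 := congrArg (fun T : H →ₗ[ℂ] H => ⟪w, T w⟫_ℂ) ht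
      simp only [LinearMap.sum_apply, LinearMap.comp_apply, ContinuousLinearMap.coe_coe,
        InnerProductSpace.rankOne_apply, LinearMap.smul_apply, hw, map_smul, inner_sum,
        inner_smul_right, zero_smul, smul_zero,
        inner_zero_right] at h2
      have h3 : ∀ i, ⟪u, LinearMap.adjoint N (LinearMap.adjoint (K i) w)⟫_ℂ * ⟪w, K i (N u)⟫_ℂ
          = ((‖⟪w, K i (N u)⟫_ℂ‖ ^ 2 : ℝ) : ℂ) := by
        intro i
        rw [LinearMap.adjoint_inner_right, LinearMap.adjoint_inner_right,
          ← inner_conj_symm, mul_comm, Complex.mul_conj, Complex.normSq_eq_norm_sq]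
      simp only [h3] at h2
      have h4 : ∑ i, ‖⟪w, K i (N u)⟫_ℂ‖ ^ 2 = 0 := by
        exact_mod_cast h2
      have h5 := (Finset.sum_eq_zero_iff_of_nonneg (fun i _ => by positivity)).mp h4 j
        (Finset.mem_univ _)
      simpa using h5
    refine ⟨⟪u, K j (N u)⟫_ℂ, ?_⟩
    set v := K j (N u) with hv
    have hw : ⟪u, v - ⟪u, v⟫_ℂ • u⟫_ℂ = 0 := by
      rw [inner_sub_right, inner_smul_right, inner_self_eq_norm_sq_to_K, h1]; simp
    have h6 := hperp _ hw
    have h7 : ⟪v - ⟪u, v⟫_ℂ • u, v - ⟪u, v⟫_ℂ • u⟫_ℂ = 0 := by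
      rw [inner_sub_right, h6, inner_smul_right, inner_eq_zero_symm.mp hw]; simp
    exact sub_eq_zero.mp (inner_self_eq_zero.mp h7)
  refine eigen_aux C (K j ∘ₗ N) (fun u hu => ?_)
  by_cases hu0 : u = 0
  · exact ⟨0, by simp [hu0]⟩
  have hn : (‖u‖ : ℂ) ≠ 0 := by simpa using hu0
  obtain ⟨c, hc⟩ := key ((‖u‖ : ℂ)⁻¹ • u) (C.smul_mem _ hu) (by
    rw [norm_smul]; simp [hu0])
  refine ⟨c, ?_⟩
  rw [map_smul, map_smul, smul_comm] at hc
  exact smul_right_injective H (inv_ne_zero hn) hc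

theorem exists_decoding_inner_of_correcting
    (C : Submodule ℂ H) (hC : C ≠ ⊥)
    (𝒩 : Submodule ℂ (H →ₗ[ℂ] H)) (h𝒩 : 𝒩 ≠ ⊥)
    (hnz : ∀ n : 𝒩, n ≠ 0 → (n : H →ₗ[ℂ] H) ∘ₗ projOf C ≠ 0)
    (Φ : (H →ₗ[ℂ] H) → (H →ₗ[ℂ] H)) (hΦ : Decodes 𝒩 C Φ) :
    ∃ φ : 𝒩 → 𝒩 → ℂ, IsDecodingInner C 𝒩 φ := by
  obtain ⟨⟨k, K, hK, hΦK⟩, hdec⟩ := hΦ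
  have heig : ∀ N : 𝒩, ∀ j, ∃ c : ℂ, ∀ u ∈ C, K j ((N : H →ₗ[ℂ] H) u) = c • u := by
    intro N j
    refine kraus_eigen C k K N (fun ρ hρ =>
      ⟨LinearMap.trace ℂ H (ρ ∘ₗ LinearMap.adjoint (N : H →ₗ[ℂ] H) ∘ₗ N), ?_⟩) j
    rw [← hdec ρ hρ N N.2, hΦK]
  choose l hl using heig
  have hinner : ∀ x y : H, ⟪x, y⟫_ℂ = ∑ j, ⟪K j x, K j y⟫_ℂ := by
    intro x y
    have h := congrArg (fun T : H →ₗ[ℂ] H => ⟪x, T y⟫_ℂ) hK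
    simp only [LinearMap.sum_apply, LinearMap.comp_apply, inner_sum,
      LinearMap.adjoint_inner_right, LinearMap.id_apply] at h
    exact h.symm
  have hkey : ∀ (n m : 𝒩), ∀ u ∈ C, ∀ v ∈ C, ⟪(n : H →ₗ[ℂ] H) u, (m : H →ₗ[ℂ] H) v⟫_ℂ =
      (∑ j, conj (l n j) * l m j) * ⟪u, v⟫_ℂ := by
    intro n m u hu v hv
    rw [hinner, Finset.sum_mul]
    refine Finset.sum_congr rfl (fun j _ => ?_)
    rw [hl n j u hu, hl m j v hv, inner_smul_left, inner_smul_right, mul_assoc]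
  obtain ⟨e', he', he0⟩ := (Submodule.ne_bot_iff C).mp hC
  obtain ⟨e, he, he1⟩ : ∃ e ∈ C, ‖e‖ = 1 :=
    ⟨(‖e'‖ : ℂ)⁻¹ • e', C.smul_mem _ he', by rw [norm_smul]; simp [he0]⟩
  have hkey2 : ∀ (n m : 𝒩), ∀ u ∈ C, ∀ v ∈ C, ⟪(n : H →ₗ[ℂ] H) u, (m : H →ₗ[ℂ] H) v⟫_ℂ =
      ⟪(n : H →ₗ[ℂ] H) e, (m : H →ₗ[ℂ] H) e⟫_ℂ * ⟪u, v⟫_ℂ := by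
    intro n m u hu v hv
    rw [hkey n m u hu v hv, hkey n m e he e he, inner_self_eq_norm_sq_to_K, he1]
    simp
  refine ⟨fun n m => ⟪(n : H →ₗ[ℂ] H) e, (m : H →ₗ[ℂ] H) e⟫_ℂ, ⟨⟨?_, ?_, ?_, ?_⟩, ?_, ?_⟩, ?_⟩
  · intro a b c; exact inner_add_left _ _ _
  · intro z a b; exact inner_smul_left _ _ _
  · intro a b c; exact inner_add_right _ _ _
  · intro z a b; exact inner_smul_right _ _ _
  · intro a b; exact inner_conj_symm _ _
  · intro a ha
    have hne : (a : H →ₗ[ℂ] H) e ≠ 0 := by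
      intro h0
      apply hnz a ha
      ext x
      have hx : projOf C x ∈ C := by simp [projOf]
      have := hkey2 a a _ hx _ hx
      rw [h0, inner_zero_left, zero_mul, inner_self_eq_zero] at this
      simpa using this
    show (0 : ℂ) < ⟪(a : H →ₗ[ℂ] H) e, (a : H →ₗ[ℂ] H) e⟫_ℂ
    rw [inner_self_eq_norm_sq_to_K]
    have : 0 < ‖(a : H →ₗ[ℂ] H) e‖ ^ 2 := by positivity
    have h2 := Complex.zero_lt_real.mpr this
    simpa using h2
  · intro η ρ hη hρ n m
    ext y
    refine ext_inner_left ℂ (fun x => ?_)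
    have h1 := hkey2 n m (η x) (state_range C η hη x) (ρ y) (state_range C ρ hρ y)
    simp only [LinearMap.comp_apply, LinearMap.smul_apply, inner_smul_right]
    rw [← hη.1, LinearMap.adjoint_inner_right, LinearMap.adjoint_inner_right,
      LinearMap.adjoint_inner_right, h1]
end
end

section
/- Let φ be the 𝒞-decoding inner product on 𝒩 and let {N_1,…,N_{n-1}} be an orthonormal basis of (𝒩, φ). Define K_j := P_𝒞 N_j* for j = 1,…,n−1 and K_n := I − Σ_{j=1}^{n-1} K_j* K_j. Then: Σ_{j=1}^{n} K_j* K_j = I; each P_j := K_j* K_j (j = 1,…,n−1) is an orthogonal projection with P_j P_r = δ_{jr} P_j; K_n N P_𝒞 = 0 for every N ∈ 𝒩; and the quantum channel Φ(ρ) = Σ_{j=1}^n K_j ρ K_j* satisfies Φ(N ρ N*) = tr(ρ N* N) ρ for every state ρ supported in 𝒞 and every N ∈ 𝒩, so (𝒞, Φ) is a quantum 𝒩-correcting code. -/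
open scoped InnerProductSpace ComplexConjugate ComplexOrder
open LinearMap Submodule

noncomputable section

variable {H : Type} [NormedAddCommGroup H] [InnerProductSpace ℂ H] [FiniteDimensional ℂ H]

theorem projOf_apply' (C : Submodule ℂ H) (x : H) : projOf C x = C.starProjection x := rfl

theorem projOf_idem (C : Submodule ℂ H) : projOf C * projOf C = projOf C := by
  ext x
  exact Submodule.starProjection_eq_self_iff.2 (Submodule.starProjection_apply_mem C x)

theorem projOf_star (C : Submodule ℂ H) : star (projOf C) = projOf C := by
  rw [LinearMap.star_eq_adjoint]
  symm
  rw [LinearMap.eq_adjoint_iff]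
  intro x y
  rw [projOf_apply', projOf_apply']
  exact Submodule.inner_starProjection_left_eq_right C x y

theorem projOf_trace (C : Submodule ℂ H) :
    LinearMap.trace ℂ H (projOf C) = (Module.finrank ℂ C : ℂ) := by
  apply LinearMap.IsProj.trace
  constructor
  · intro x
    simp [projOf]
  · intro x hx
    rw [projOf_apply']
    exact Submodule.starProjection_eq_self_iff.2 hx

theorem state_projOf (C : Submodule ℂ H) (hC : C ≠ ⊥) :
    IsStateOn C (((Module.finrank ℂ C : ℂ)⁻¹) • projOf C) := by
  have hd : (Module.finrank ℂ C : ℂ) ≠ 0 := by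
    rw [Nat.cast_ne_zero]
    intro h
    exact hC (Submodule.finrank_eq_zero.1 h)
  refine ⟨?_, ?_, ?_, ?_⟩
  · rw [← LinearMap.star_eq_adjoint, star_smul, projOf_star]
    simp
  · intro x
    rw [LinearMap.smul_apply, inner_smul_right]
    apply mul_nonneg
    · rw [inv_nonneg]
      exact Nat.cast_nonneg _
    · have h1 : ⟪x, projOf C x⟫_ℂ = ⟪projOf C x, projOf C x⟫_ℂ := by
        rw [projOf_apply', Submodule.inner_starProjection_left_eq_right,
          ← projOf_apply', ← projOf_apply']
        exact congrArg (fun T : H →ₗ[ℂ] H => ⟪x, T x⟫_ℂ) (projOf_idem C).symm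
      rw [h1, inner_self_eq_norm_sq_to_K]
      have h2 : (0 : ℂ) ≤ ((‖projOf C x‖ ^ 2 : ℝ) : ℂ) :=
        Complex.zero_le_real.2 (sq_nonneg ‖projOf C x‖)
      simpa using h2
  · rw [map_smul, projOf_trace, smul_eq_mul, inv_mul_cancel₀ hd]
  · unfold supp
    rw [Submodule.orthogonal_le_iff_orthogonal_le]
    intro x hx
    rw [LinearMap.mem_ker, LinearMap.smul_apply, projOf_apply',
      (Submodule.starProjection_apply_eq_zero_iff C).2 hx, smul_zero]

theorem decoding_projOf (C : Submodule ℂ H) (hC : C ≠ ⊥)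
    (𝒩 : Submodule ℂ (H →ₗ[ℂ] H)) (φ : 𝒩 → 𝒩 → ℂ) (hφ : IsDecodingInner C 𝒩 φ) (n m : 𝒩) :
    projOf C * (star (n : H →ₗ[ℂ] H) * (m : H →ₗ[ℂ] H)) * projOf C = φ n m • projOf C := by
  have hd : (Module.finrank ℂ C : ℂ) ≠ 0 := by
    rw [Nat.cast_ne_zero]
    intro h
    exact hC (Submodule.finrank_eq_zero.1 h)
  have h := hφ.2 _ _ (state_projOf C hC) (state_projOf C hC) n m
  simp only [← LinearMap.star_eq_adjoint, ← Module.End.mul_eq_comp, smul_mul_assoc,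
    mul_smul_comm, projOf_idem] at h
  rw [smul_comm (φ n m), smul_comm (φ n m)] at h
  have h2 := smul_right_injective _ (inv_ne_zero hd) (smul_right_injective _ (inv_ne_zero hd) h)
  rw [mul_assoc]
  exact h2

theorem state_mul_projOf (C : Submodule ℂ H) (ρ : H →ₗ[ℂ] H) (h : IsStateOn C ρ) :
    ρ * projOf C = ρ := by
  ext x
  have h4 := h.2.2.2
  unfold supp at h4
  have hx : x - projOf C x ∈ LinearMap.ker ρ := by
    have h5 : Cᗮ ≤ LinearMap.ker ρ := by
      rw [Submodule.orthogonal_le_iff_orthogonal_le]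
      exact h4
    exact h5 (Submodule.sub_starProjection_mem_orthogonal x)
  rw [LinearMap.mem_ker, map_sub, sub_eq_zero] at hx
  exact hx.symm

theorem projOf_mul_state (C : Submodule ℂ H) (ρ : H →ₗ[ℂ] H) (h : IsStateOn C ρ) :
    projOf C * ρ = ρ := by
  have h1 := congrArg star (state_mul_projOf C ρ h)
  have h2 : star ρ = ρ := h.1
  rwa [star_mul, projOf_star, h2] at h1

/-- **Theorem 3.4 (second half).**  If `φ` is the `C`-decoding inner product on `𝒩` and
`{N_1,…,N_{n-1}}` is a `φ`-orthonormal basis of `𝒩`, then the operators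
`K_j = P_C N_j*` and `K_n = I - Σ_j K_j* K_j` are Kraus operators of a quantum channel `Φ`
which decodes `C`; moreover the `P_j = K_j* K_j` are pairwise orthogonal projections and
`K_n N P_C = 0` for all `N ∈ 𝒩`. -/
theorem decoding_channel_of_inner
    (C : Submodule ℂ H) (hC : C ≠ ⊥)
    (𝒩 : Submodule ℂ (H →ₗ[ℂ] H)) (h𝒩 : 𝒩 ≠ ⊥)
    (φ : 𝒩 → 𝒩 → ℂ) (hφ : IsDecodingInner C 𝒩 φ)
    (r : ℕ) (Nb : Fin r → 𝒩)
    (honb : ∀ j k, φ (Nb j) (Nb k) = if j = k then 1 else 0)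
    (hspan : Submodule.span ℂ (Set.range Nb) = (⊤ : Submodule ℂ 𝒩))
    (K : Fin r → (H →ₗ[ℂ] H))
    (hK : ∀ j, K j = projOf C ∘ₗ LinearMap.adjoint (Nb j : H →ₗ[ℂ] H))
    (Klast : H →ₗ[ℂ] H)
    (hKlast : Klast = LinearMap.id - ∑ j, LinearMap.adjoint (K j) ∘ₗ K j) :
    ((∑ j, LinearMap.adjoint (K j) ∘ₗ K j) + LinearMap.adjoint Klast ∘ₗ Klast
        = LinearMap.id) ∧
    (∀ j, LinearMap.adjoint (LinearMap.adjoint (K j) ∘ₗ K j)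
        = LinearMap.adjoint (K j) ∘ₗ K j) ∧
    (∀ j k, (LinearMap.adjoint (K j) ∘ₗ K j) ∘ₗ (LinearMap.adjoint (K k) ∘ₗ K k)
        = if j = k then LinearMap.adjoint (K j) ∘ₗ K j else 0) ∧
    (∀ N ∈ 𝒩, Klast ∘ₗ N ∘ₗ projOf C = 0) ∧
    Decodes 𝒩 C (fun ρ =>
      (∑ j, K j ∘ₗ ρ ∘ₗ LinearMap.adjoint (K j)) + Klast ∘ₗ ρ ∘ₗ LinearMap.adjoint Klast) := by
  have hP2 := projOf_idem C
  have hPs := projOf_star C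
  have key := decoding_projOf C hC 𝒩 φ hφ
  have hρr := state_mul_projOf C
  have hρl := projOf_mul_state C
  generalize projOf C = P at *
  unfold Decodes IsQuantumChannel
  simp only [← LinearMap.star_eq_adjoint, ← Module.End.mul_eq_comp, ← Module.End.one_eq_id] at *
  have hKs : ∀ j, star (K j) = (Nb j : H →ₗ[ℂ] H) * P := by
    intro j
    rw [hK, star_mul, star_star, hPs]
  have hKK : ∀ j k, K j * star (K k) = if j = k then P else 0 := by
    intro j k
    rw [hKs, hK, ← mul_assoc, mul_assoc P, key, honb]
    split_ifs <;> simp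
  have hKsP : ∀ j, star (K j) * P = star (K j) := by
    intro j
    rw [hKs, mul_assoc, hP2]
  have h3 : ∀ j k, (star (K j) * K j) * (star (K k) * K k)
      = if j = k then star (K j) * K j else 0 := by
    intro j k
    rw [mul_assoc, ← mul_assoc (K j), hKK]
    split_ifs with h
    · subst h
      rw [← mul_assoc, hKsP]
    · simp
  have h2 : ∀ j, star (star (K j) * K j) = star (K j) * K j := by
    intro j
    rw [star_mul, star_star]
  have hSs : star (∑ j, star (K j) * K j) = ∑ j, star (K j) * K j := by
    rw [star_sum]
    exact Finset.sum_congr rfl fun j _ => h2 j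
  have hSS : (∑ j, star (K j) * K j) * (∑ j, star (K j) * K j) = ∑ j, star (K j) * K j := by
    rw [Finset.sum_mul_sum]
    simp [h3]
  have hLs : star Klast = Klast := by
    rw [hKlast, star_sub, star_one, hSs]
  have hLL : Klast * Klast = Klast := by
    rw [hKlast, sub_mul, one_mul, mul_sub, mul_one, hSS, sub_self, sub_zero]
  have h1 : (∑ j, star (K j) * K j) + star Klast * Klast = 1 := by
    rw [hLs, hLL, hKlast]
    abel
  have h4b : ∀ k, Klast * ((Nb k : H →ₗ[ℂ] H) * P) = 0 := by
    intro k
    rw [← hKs, hKlast, sub_mul, one_mul, Finset.sum_mul, sub_eq_zero]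
    simp [mul_assoc, hKK, hKsP]
  have h4' : ∀ N : 𝒩, Klast * ((N : H →ₗ[ℂ] H) * P) = 0 := by
    intro N
    have hN : N ∈ Submodule.span ℂ (Set.range Nb) := by
      rw [hspan]
      exact Submodule.mem_top
    induction hN using Submodule.span_induction with
    | mem x hx =>
      obtain ⟨k, rfl⟩ := hx
      exact h4b k
    | zero => simp
    | add x y _ _ hx hy => rw [Submodule.coe_add, add_mul, mul_add, hx, hy, add_zero]
    | smul a x _ hx => rw [Submodule.coe_smul, smul_mul_assoc, mul_smul_comm, hx, smul_zero]
  have h4 : ∀ N ∈ 𝒩, Klast * (N * P) = 0 := fun N hN => h4' ⟨N, hN⟩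
  refine ⟨h1, h2, h3, h4, ⟨r + 1, Fin.snoc K Klast, ?_, ?_⟩, ?_⟩
  · rw [Fin.sum_univ_castSucc]
    simpa using h1
  · intro ρ
    rw [Fin.sum_univ_castSucc]
    simp
  · intro ρ hρ N hN
    have hr := hρr ρ hρ
    have hl := hρl ρ hρ
    have htr : LinearMap.trace ℂ H ρ = 1 := hρ.2.2.1
    have hA : ∀ j, K j * (N * P) = φ (Nb j) ⟨N, hN⟩ • P := by
      intro j
      rw [hK, ← key]
      simp only [mul_assoc]
    have hB : ∀ j, P * star N * star (K j) = φ ⟨N, hN⟩ (Nb j) • P := by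
      intro j
      rw [hKs, ← key]
      simp only [mul_assoc]
    have hT : LinearMap.trace ℂ H (ρ * (star N * N)) = φ ⟨N, hN⟩ ⟨N, hN⟩ := by
      have e : ρ * (star N * N) = P * (ρ * (star N * N)) := by
        rw [← mul_assoc P, hl]
      have e2 : ρ * (star N * N) * P = ρ * (P * (star N * N) * P) := by
        conv_lhs => rw [← hr]
        simp only [mul_assoc]
      rw [e, LinearMap.trace_mul_comm, e2, key ⟨N, hN⟩ ⟨N, hN⟩, mul_smul_comm, hr, map_smul, htr]
      simp
    have hPar : φ ⟨N, hN⟩ ⟨N, hN⟩ • P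
        = ∑ j, (φ (Nb j) ⟨N, hN⟩ * φ ⟨N, hN⟩ (Nb j)) • P := by
      have z : N * P = ∑ j, star (K j) * K j * (N * P) := by
        have := h4 N hN
        rw [hKlast, sub_mul, one_mul, sub_eq_zero, Finset.sum_mul] at this
        exact this
      rw [← key ⟨N, hN⟩ ⟨N, hN⟩]
      have e : P * (star N * N) * P = P * star N * (N * P) := by simp only [mul_assoc]
      change P * (star N * N) * P = _
      rw [e, z, Finset.mul_sum]
      refine Finset.sum_congr rfl fun j _ => ?_
      rw [mul_assoc (star (K j)), hA, ← mul_assoc, hB, smul_mul_smul_comm, hP2, mul_comm]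
    have hL : Klast * (N * (ρ * star N) * star Klast) = 0 := by
      have e : Klast * (N * (ρ * star N) * star Klast)
          = Klast * (N * P) * (ρ * star N * star Klast) := by
        conv_lhs => rw [← hl]
        simp only [mul_assoc]
      rw [e, h4 N hN, zero_mul]
    have hJ : ∀ j, K j * (N * (ρ * star N) * star (K j))
        = (φ (Nb j) ⟨N, hN⟩ * φ ⟨N, hN⟩ (Nb j)) • P * ρ := by
      intro j
      have e : K j * (N * (ρ * star N) * star (K j))
          = K j * (N * P) * (ρ * (P * star N * star (K j))) := by
        conv_lhs => rw [← hl]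
        conv_lhs => rw [← hr]
        simp only [mul_assoc]
      rw [e, hA, hB, mul_smul_comm, hr, smul_mul_smul_comm, smul_mul_assoc]
    rw [hL, add_zero, hT, Finset.sum_congr rfl fun j _ => hJ j, ← Finset.sum_mul, ← hPar,
      smul_mul_assoc, hl]
end
end

section
/- Assume N P_𝒞 ≠ 0 for every nonzero N ∈ 𝒩, and fix an orthonormal basis {u_1,…,u_s} of 𝒞. Then the following are equivalent (Knill–Laflamme conditions): (i) 𝒞 is a quantum 𝒩-correcting code; (ii) for all N, M ∈ 𝒩 there exists a (unique) λ_{N,M} ∈ ℂ such that ⟨u_i, N* M u_j⟩ = δ_{ij} λ_{N,M} for all i, j; (iii) for all N, M ∈ 𝒩 there exists a (unique) λ_{N,M} ∈ ℂ such that P_𝒞 N* M P_𝒞 = λ_{N,M} P_𝒞. -/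
open scoped InnerProductSpace ComplexConjugate ComplexOrder
open LinearMap Submodule

noncomputable section

variable {H : Type} [NormedAddCommGroup H] [InnerProductSpace ℂ H] [FiniteDimensional ℂ H]

lemma projOf_mem (C : Submodule ℂ H) (x : H) : projOf C x ∈ C := by
  simp [projOf]

lemma projOf_eq (C : Submodule ℂ H) {x : H} (hx : x ∈ C) : projOf C x = x := by
  have := C.starProjection_eq_self_iff.2 hx
  simpa [projOf] using this

lemma inner_projOf_right (C : Submodule ℂ H) {x : H} (hx : x ∈ C) (y : H) :
    ⟪x, projOf C y⟫_ℂ = ⟪x, y⟫_ℂ := by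
  have := C.inner_starProjection_left_eq_right x y
  rw [C.starProjection_eq_self_iff.2 hx] at this
  simpa [projOf] using this.symm

lemma projOf_adjoint (C : Submodule ℂ H) : LinearMap.adjoint (projOf C) = projOf C := by
  refine ((LinearMap.eq_adjoint_iff _ _).2 fun x y => ?_).symm
  rw [← inner_projOf_right C (projOf_mem C x) y, ← inner_conj_symm x,
    ← inner_projOf_right C (projOf_mem C y) x, inner_conj_symm]

/-- Two vectors of `C` with the same inner products against `C` agree. -/
lemma eq_of_inner_mem (C : Submodule ℂ H) {x y : H} (hx : x ∈ C) (hy : y ∈ C)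
    (h : ∀ z ∈ C, ⟪z, x⟫_ℂ = ⟪z, y⟫_ℂ) : x = y := by
  rw [← sub_eq_zero, ← inner_self_eq_zero (𝕜 := ℂ), inner_sub_right,
    h _ (C.sub_mem hx hy), sub_self]

/-- A linear map for which every vector of `C` is an eigenvector is scalar on `C`. -/
lemma scalar_of_eigen (C : Submodule ℂ H) (f : H →ₗ[ℂ] H)
    (h : ∀ x ∈ C, ∃ c : ℂ, f x = c • x) : ∃ c : ℂ, ∀ x ∈ C, f x = c • x := by
  by_cases hC : ∃ x0 ∈ C, x0 ≠ 0
  · obtain ⟨x0, hx0, hne⟩ := hC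
    obtain ⟨a, ha⟩ := h x0 hx0
    refine ⟨a, fun x hx => ?_⟩
    obtain ⟨b, hb⟩ := h x hx
    obtain ⟨g, hg⟩ := h (x0 + x) (C.add_mem hx0 hx)
    rw [map_add, ha, hb] at hg
    have e : (a - g) • x0 = (g - b) • x := by
      linear_combination (norm := module) hg
    by_cases hgb : g - b = 0
    · rw [hgb, zero_smul, smul_eq_zero] at e
      have e1 := e.resolve_right hne
      have : b = a := by linear_combination -hgb - e1
      rw [hb, this]
    · have hx' : x = ((g - b)⁻¹ * (a - g)) • x0 := by
        rw [mul_smul, e, smul_smul, inv_mul_cancel₀ hgb, one_smul]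
      rw [hx', map_smul, ha, smul_comm]
  · push Not at hC
    exact ⟨0, fun x hx => by simp [hC x hx]⟩

/-- The rank-one projection on a unit vector is a state. -/
lemma isStateOn_rankOne (C : Submodule ℂ H) {x : H} (hx : x ∈ C) (h1 : ⟪x, x⟫_ℂ = 1) :
    IsStateOn C ((innerₛₗ ℂ x).smulRight x) := by
  refine ⟨?_, ?_, ?_, ?_⟩
  · refine ((LinearMap.eq_adjoint_iff _ _).2 fun y z => ?_).symm
    simp [inner_smul_left, inner_smul_right]
    ring
  · intro y
    have : ⟪y, ((innerₛₗ ℂ x).smulRight x) y⟫_ℂ = ⟪x, y⟫_ℂ * conj ⟪x, y⟫_ℂ := by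
      simp [inner_smul_right]
    rw [this, Complex.mul_conj]
    exact_mod_cast Complex.normSq_nonneg _
  · rw [LinearMap.trace_smulRight]
    simpa using h1
  · intro y hy
    have hz : y - ⟪x, y⟫_ℂ • x ∈ LinearMap.ker ((innerₛₗ ℂ x).smulRight x) := by
      simp only [LinearMap.mem_ker, LinearMap.smulRight_apply, innerₛₗ_apply_apply, inner_sub_right,
        inner_smul_right, h1]
      simp
    have h2 := (Submodule.mem_orthogonal _ _).1 hy _ hz
    have h3 : y - ⟪x, y⟫_ℂ • x = 0 := by
      rw [← inner_self_eq_zero (𝕜 := ℂ), inner_sub_right, h2, inner_smul_right, inner_sub_left,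
        inner_smul_left, h1, inner_conj_symm]
      ring
    rw [sub_eq_zero.1 h3]
    exact C.smul_mem _ hx

/-- (i) implies the basis-free Knill–Laflamme condition. -/
lemma kl_of_decodes (C : Submodule ℂ H) (𝒩 : Submodule ℂ (H →ₗ[ℂ] H))
    (Φ : (H →ₗ[ℂ] H) → (H →ₗ[ℂ] H)) (hΦ : Decodes 𝒩 C Φ) :
    ∀ N ∈ 𝒩, ∀ M ∈ 𝒩, ∃ lam : ℂ, ∀ x ∈ C, ∀ y ∈ C, ⟪N x, M y⟫_ℂ = lam * ⟪x, y⟫_ℂ := by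
  obtain ⟨⟨n, K, hK, hΦK⟩, hdec⟩ := hΦ
  have unit : ∀ N ∈ 𝒩, ∀ x ∈ C, ⟪x, x⟫_ℂ = 1 → ∀ j, ∃ c : ℂ, K j (N x) = c • x := by
    intro N hN x hx h1 j
    have hd := hdec _ (isStateOn_rankOne C hx h1) N hN
    rw [hΦK] at hd
    have key : K j (N x) ∈ (ℂ ∙ x)ᗮᗮ := by
      rw [Submodule.mem_orthogonal]
      intro y hy
      have hxy : ⟪x, y⟫_ℂ = 0 := Submodule.mem_orthogonal_singleton_iff_inner_right.1 hy
      have e := congrArg (fun T : H →ₗ[ℂ] H => ⟪y, T y⟫_ℂ) hd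
      simp only [LinearMap.sum_apply, LinearMap.comp_apply, LinearMap.smulRight_apply,
        LinearMap.smul_apply, innerₛₗ_apply_apply, hxy, zero_smul, smul_zero, inner_zero_right,
        inner_sum, map_smul, inner_smul_right, LinearMap.adjoint_inner_right] at e
      have e2 : ∑ i, Complex.normSq ⟪y, K i (N x)⟫_ℂ = 0 := by
        have : ((∑ i, Complex.normSq ⟪y, K i (N x)⟫_ℂ : ℝ) : ℂ) = 0 := by
          rw [← e]
          push_cast
          refine Finset.sum_congr rfl fun i _ => ?_
          rw [← Complex.mul_conj, inner_conj_symm, mul_comm]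
        exact_mod_cast this
      have e3 := (Finset.sum_eq_zero_iff_of_nonneg
        (fun i _ => Complex.normSq_nonneg _)).1 e2 j (Finset.mem_univ j)
      exact Complex.normSq_eq_zero.1 e3
    rw [Submodule.orthogonal_orthogonal, Submodule.mem_span_singleton] at key
    obtain ⟨c, hc⟩ := key
    exact ⟨c, hc.symm⟩
  have eig : ∀ N ∈ 𝒩, ∀ j, ∃ c : ℂ, ∀ x ∈ C, K j (N x) = c • x := by
    intro N hN j
    refine scalar_of_eigen C (K j ∘ₗ N) fun x hx => ?_
    by_cases h0 : x = 0
    · exact ⟨0, by simp [h0]⟩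
    · have hn : (‖x‖ : ℂ) ≠ 0 := by simpa using h0
      obtain ⟨c, hc⟩ := unit N hN ((‖x‖ : ℂ)⁻¹ • x) (C.smul_mem _ hx) (by
        rw [inner_smul_left, inner_smul_right, inner_self_eq_norm_sq_to_K]
        simp
        field_simp) j
      refine ⟨c, ?_⟩
      rw [map_smul, map_smul, smul_comm] at hc
      exact smul_right_injective H (inv_ne_zero hn) hc
  intro N hN M hM
  choose a ha using eig N hN
  choose b hb using eig M hM
  refine ⟨∑ j, conj (a j) * b j, fun x hx y hy => ?_⟩
  have : M y = ∑ j, LinearMap.adjoint (K j) (K j (M y)) := by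
    have := congrArg (fun T : H →ₗ[ℂ] H => T (M y)) hK
    simpa using this.symm
  rw [this, inner_sum, Finset.sum_mul]
  refine Finset.sum_congr rfl fun j _ => ?_
  rw [LinearMap.adjoint_inner_right, ha j x hx, hb j y hy, inner_smul_left, inner_smul_right]
  ring

/-- The basis-free Knill–Laflamme condition implies (i). -/
lemma decodes_of_kl (C : Submodule ℂ H) (hC : C ≠ ⊥) (𝒩 : Submodule ℂ (H →ₗ[ℂ] H))
    (h : ∀ N ∈ 𝒩, ∀ M ∈ 𝒩, ∃ lam : ℂ, ∀ x ∈ C, ∀ y ∈ C, ⟪N x, M y⟫_ℂ = lam * ⟪x, y⟫_ℂ) :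
    ∃ Φ, Decodes 𝒩 C Φ := by
  obtain ⟨x0, hx0, h1⟩ : ∃ x ∈ C, ⟪x, x⟫_ℂ = 1 := by
    obtain ⟨x, hx, hne⟩ := Submodule.exists_mem_ne_zero_of_ne_bot hC
    have hn : (‖x‖ : ℂ) ≠ 0 := by simpa using hne
    refine ⟨(‖x‖ : ℂ)⁻¹ • x, C.smul_mem _ hx, ?_⟩
    rw [inner_smul_left, inner_smul_right, inner_self_eq_norm_sq_to_K]
    simp
    field_simp
  have h' : ∀ N ∈ 𝒩, ∀ M ∈ 𝒩, ∀ x ∈ C, ∀ y ∈ C,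
      ⟪N x, M y⟫_ℂ = ⟪N x0, M x0⟫_ℂ * ⟪x, y⟫_ℂ := by
    intro N hN M hM x hx y hy
    obtain ⟨l, hl⟩ := h N hN M hM
    rw [hl x hx y hy, hl x0 hx0 x0 hx0, h1, mul_one]
  let W : Submodule ℂ H := 𝒩.map (LinearMap.applyₗ x0)
  let b := stdOrthonormalBasis ℂ W
  have hb : ∀ a, ∃ N ∈ 𝒩, N x0 = (b a : H) := fun a => by
    obtain ⟨N, hN, e⟩ := (b a).2
    exact ⟨N, hN, e⟩
  choose E hE hEx using hb
  have expand : ∀ N ∈ 𝒩, ∀ x ∈ C, ∑ a, ⟪E a x0, N x0⟫_ℂ • E a x = N x := by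
    intro N hN x hx
    have hD : ∑ a, ⟪E a x0, N x0⟫_ℂ • E a - N ∈ 𝒩 :=
      𝒩.sub_mem (𝒩.sum_mem fun a _ => 𝒩.smul_mem _ (hE a)) hN
    have hD0 : (∑ a, ⟪E a x0, N x0⟫_ℂ • E a - N) x0 = 0 := by
      have e := b.sum_repr' ⟨N x0, ⟨N, hN, rfl⟩⟩
      have e2 := congrArg (Subtype.val) e
      simp only [Submodule.coe_sum, Submodule.coe_smul, Submodule.coe_inner] at e2
      simp only [LinearMap.sub_apply, LinearMap.sum_apply, LinearMap.smul_apply, hEx, e2, sub_self]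
    have e := h' _ hD _ hD x hx x hx
    rw [hD0, inner_zero_right, zero_mul, inner_self_eq_zero] at e
    simpa [sub_eq_zero] using e
  have hPN : ∀ N ∈ 𝒩, ∀ M ∈ 𝒩, ∀ x ∈ C,
      projOf C (LinearMap.adjoint N (M x)) = ⟪N x0, M x0⟫_ℂ • x := by
    intro N hN M hM x hx
    refine eq_of_inner_mem C (projOf_mem C _) (C.smul_mem _ hx) fun z hz => ?_
    rw [inner_projOf_right C hz, LinearMap.adjoint_inner_right, h' N hN M hM z hz x hx,
      inner_smul_right]
  let L := fun a => projOf C ∘ₗ LinearMap.adjoint (E a)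
  have hLadj : ∀ a, LinearMap.adjoint (L a) = E a ∘ₗ projOf C := fun a => by
    simp only [L, LinearMap.adjoint_comp, LinearMap.adjoint_adjoint, projOf_adjoint]
  let Q : H →ₗ[ℂ] H := ∑ a, LinearMap.adjoint (L a) ∘ₗ L a
  have hQN : ∀ N ∈ 𝒩, ∀ x ∈ C, Q (N x) = N x := by
    intro N hN x hx
    rw [← expand N hN x hx]
    conv_lhs => rw [expand N hN x hx]
    simp only [Q, LinearMap.sum_apply, LinearMap.comp_apply, hLadj]
    refine Finset.sum_congr rfl fun a _ => ?_
    simp only [L, LinearMap.comp_apply]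
    rw [projOf_eq C (projOf_mem C _), hPN _ (hE a) N hN x hx, map_smul]
  have hQQ : Q ∘ₗ Q = Q := by
    ext z
    have : Q z = ∑ a, E a (L a z) := by
      simp only [Q, LinearMap.sum_apply, LinearMap.comp_apply, hLadj]
      refine Finset.sum_congr rfl fun a _ => ?_
      simp only [L, LinearMap.comp_apply]
      rw [projOf_eq C (projOf_mem C _)]
    rw [LinearMap.comp_apply, this, map_sum]
    exact Finset.sum_congr rfl fun a _ => hQN _ (hE a) _ (projOf_mem C _)
  have hQadj : LinearMap.adjoint Q = Q := by
    simp only [Q, map_sum, LinearMap.adjoint_comp, LinearMap.adjoint_adjoint]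
  let K : Fin (Module.finrank ℂ W + 1) → (H →ₗ[ℂ] H) := Fin.cons (LinearMap.id - Q) L
  refine ⟨fun ρ => ∑ j, K j ∘ₗ ρ ∘ₗ LinearMap.adjoint (K j), ⟨_, K, ?_, fun _ => rfl⟩, ?_⟩
  · rw [Fin.sum_univ_succ]
    simp only [K, Fin.cons_zero, Fin.cons_succ]
    change _ + Q = _
    rw [map_sub, hQadj, LinearMap.adjoint_id]
    have : (LinearMap.id - Q) ∘ₗ (LinearMap.id - Q) = LinearMap.id - Q := by
      rw [LinearMap.sub_comp, LinearMap.comp_sub, LinearMap.comp_sub, hQQ]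
      simp
    rw [this, sub_add_cancel]
  · rintro ρ ⟨hadj, -, htr, hsupp⟩ N hN
    have hρ : ∀ x, ρ x ∈ C := by
      intro x
      refine hsupp ((Submodule.mem_orthogonal _ _).2 fun z hz => ?_)
      rw [← hadj, LinearMap.adjoint_inner_right, LinearMap.mem_ker.1 hz, inner_zero_left]
    have hK0 : (LinearMap.id - Q) ∘ₗ N ∘ₗ ρ = 0 := by
      ext x
      simp [hQN N hN _ (hρ x)]
    have hKa : ∀ a, L a ∘ₗ N ∘ₗ ρ = ⟪E a x0, N x0⟫_ℂ • ρ := by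
      intro a
      ext x
      simp [L, hPN _ (hE a) N hN _ (hρ x)]
    have hPρ : projOf C ∘ₗ ρ = ρ := by
      ext x
      exact projOf_eq C (hρ x)
    have hρP : ρ ∘ₗ projOf C = ρ := by
      have := congrArg LinearMap.adjoint hPρ
      rwa [LinearMap.adjoint_comp, projOf_adjoint, hadj] at this
    have htrace : LinearMap.trace ℂ H (ρ ∘ₗ LinearMap.adjoint N ∘ₗ N) = ⟪N x0, N x0⟫_ℂ := by
      have e : (projOf C ∘ₗ LinearMap.adjoint N ∘ₗ N) ∘ₗ ρ = ⟪N x0, N x0⟫_ℂ • ρ := by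
        ext x
        simp [hPN N hN N hN _ (hρ x)]
      rw [← hρP, LinearMap.comp_assoc, LinearMap.trace_comp_comm', e, map_smul, htr, smul_eq_mul,
        mul_one]
    have hsum : ∑ a, ⟪N x0, E a x0⟫_ℂ * ⟪E a x0, N x0⟫_ℂ = ⟪N x0, N x0⟫_ℂ := by
      conv_rhs => rw [← expand N hN x0 hx0]
      conv_rhs => rw [expand N hN x0 hx0]
      have := b.sum_inner_mul_inner ⟨N x0, ⟨N, hN, rfl⟩⟩ ⟨N x0, ⟨N, hN, rfl⟩⟩
      simpa only [Submodule.coe_inner, hEx] using this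
    change ∑ j, K j ∘ₗ (N ∘ₗ ρ ∘ₗ LinearMap.adjoint N) ∘ₗ LinearMap.adjoint (K j) = _
    rw [htrace, Fin.sum_univ_succ, ← hsum, Finset.sum_smul]
    simp only [K, Fin.cons_zero, Fin.cons_succ]
    have z : (LinearMap.id - Q) ∘ₗ (N ∘ₗ ρ ∘ₗ LinearMap.adjoint N) ∘ₗ
        LinearMap.adjoint (LinearMap.id - Q) = 0 := by
      have : (LinearMap.id - Q) ∘ₗ (N ∘ₗ ρ ∘ₗ LinearMap.adjoint N) ∘ₗ
        LinearMap.adjoint (LinearMap.id - Q) = ((LinearMap.id - Q) ∘ₗ N ∘ₗ ρ) ∘ₗ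
          LinearMap.adjoint N ∘ₗ LinearMap.adjoint (LinearMap.id - Q) := by
        simp only [LinearMap.comp_assoc]
      rw [this, hK0, LinearMap.zero_comp]
    rw [z, zero_add]
    refine Finset.sum_congr rfl fun a _ => ?_
    have e1 : L a ∘ₗ (N ∘ₗ ρ ∘ₗ LinearMap.adjoint N) ∘ₗ LinearMap.adjoint (L a) =
        (L a ∘ₗ N ∘ₗ ρ) ∘ₗ LinearMap.adjoint N ∘ₗ LinearMap.adjoint (L a) := by
      simp only [LinearMap.comp_assoc]
    have e2 : ρ ∘ₗ LinearMap.adjoint N ∘ₗ LinearMap.adjoint (L a) = ⟪N x0, E a x0⟫_ℂ • ρ := by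
      have := congrArg LinearMap.adjoint (hKa a)
      rw [LinearMap.adjoint_comp, LinearMap.adjoint_comp, hadj, map_smulₛₗ, hadj,
        inner_conj_symm, LinearMap.comp_assoc] at this
      exact this
    rw [e1, hKa, LinearMap.smul_comp, e2, smul_smul, mul_comm]

/-- The Knill–Laflamme condition in a basis implies the basis-free one. -/
lemma kl_of_basis (C : Submodule ℂ H) (s : ℕ) (u : Fin s → H)
    (horth : Orthonormal ℂ u) (hspan : Submodule.span ℂ (Set.range u) = C)
    (N M : H →ₗ[ℂ] H) (lam : ℂ)
    (h : ∀ i j, ⟪u i, (LinearMap.adjoint N ∘ₗ M) (u j)⟫_ℂ = if i = j then lam else 0) :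
    ∀ x ∈ C, ∀ y ∈ C, ⟪N x, M y⟫_ℂ = lam * ⟪x, y⟫_ℂ := by
  intro x hx y hy
  rw [← hspan, Submodule.mem_span_range_iff_exists_fun] at hx hy
  obtain ⟨c, rfl⟩ := hx
  obtain ⟨d, rfl⟩ := hy
  have h2 : ∀ i j, ⟪N (u i), M (u j)⟫_ℂ = lam * ⟪u i, u j⟫_ℂ := by
    intro i j
    rw [← LinearMap.adjoint_inner_right, ← LinearMap.comp_apply, h,
      orthonormal_iff_ite.1 horth i j]
    simp
  simp only [map_sum, map_smul, sum_inner, inner_sum, inner_smul_left, inner_smul_right, h2,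
    Finset.mul_sum]
  refine Finset.sum_congr rfl fun i _ => Finset.sum_congr rfl fun j _ => ?_
  ring

/-- **Corollary 3.5 (Knill–Laflamme conditions).** -/
theorem knill_laflamme_tfae
    (C : Submodule ℂ H) (hC : C ≠ ⊥)
    (𝒩 : Submodule ℂ (H →ₗ[ℂ] H)) (h𝒩 : 𝒩 ≠ ⊥)
    (hnz : ∀ n : 𝒩, n ≠ 0 → (n : H →ₗ[ℂ] H) ∘ₗ projOf C ≠ 0)
    (s : ℕ) (u : Fin s → H) (hmem : ∀ i, u i ∈ C)
    (horth : Orthonormal ℂ u)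
    (hspan : Submodule.span ℂ (Set.range u) = C) :
    List.TFAE
      [ -- (i) `C` is a quantum `𝒩`-correcting code
        ∃ Φ, Decodes 𝒩 C Φ,
        -- (ii) `⟪u_i, N* M u_j⟫ = δ_{ij} λ_{N,M}`
        ∀ N ∈ 𝒩, ∀ M ∈ 𝒩, ∃! lam : ℂ, ∀ i j,
          ⟪u i, (LinearMap.adjoint N ∘ₗ M) (u j)⟫_ℂ = if i = j then lam else 0,
        -- (iii) `P_C N* M P_C = λ_{N,M} P_C`
        ∀ N ∈ 𝒩, ∀ M ∈ 𝒩, ∃! lam : ℂ,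
          projOf C ∘ₗ (LinearMap.adjoint N ∘ₗ M) ∘ₗ projOf C = lam • projOf C ] := by
  obtain ⟨i0⟩ : Nonempty (Fin s) := by
    by_contra hne
    rw [not_nonempty_iff] at hne
    exact hC (by rw [← hspan, Set.range_eq_empty, Submodule.span_empty])
  tfae_have 1 → 2 := by
    rintro ⟨Φ, hΦ⟩ N hN M hM
    obtain ⟨l, hl⟩ := kl_of_decodes C 𝒩 Φ hΦ N hN M hM
    refine ⟨l, fun i j => ?_, fun l' hl' => ?_⟩
    · rw [LinearMap.comp_apply, LinearMap.adjoint_inner_right, hl _ (hmem i) _ (hmem j),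
        orthonormal_iff_ite.1 horth i j]
      simp
    · have e := hl' i0 i0
      rw [LinearMap.comp_apply, LinearMap.adjoint_inner_right, hl _ (hmem i0) _ (hmem i0),
        orthonormal_iff_ite.1 horth i0 i0] at e
      simpa using e.symm
  tfae_have 2 → 3 := by
    intro h N hN M hM
    obtain ⟨l, hl, -⟩ := h N hN M hM
    have hk := kl_of_basis C s u horth hspan N M l hl
    have e : projOf C ∘ₗ (LinearMap.adjoint N ∘ₗ M) ∘ₗ projOf C = l • projOf C := by
      ext x
      refine eq_of_inner_mem C (projOf_mem C _) (C.smul_mem _ (projOf_mem C _)) fun z hz => ?_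
      simp only [LinearMap.comp_apply]
      rw [inner_projOf_right C hz, LinearMap.adjoint_inner_right, hk z hz _ (projOf_mem C _),
        LinearMap.smul_apply, inner_smul_right]
    refine ⟨l, e, fun l' hl' => ?_⟩
    have e2 := congrArg (fun T : H →ₗ[ℂ] H => T (u i0)) (hl'.symm.trans e)
    simp only [LinearMap.smul_apply, projOf_eq C (hmem i0)] at e2
    exact smul_left_injective ℂ (horth.ne_zero i0) e2
  tfae_have 3 → 1 := by
    intro h
    refine decodes_of_kl C hC 𝒩 fun N hN M hM => ?_
    obtain ⟨l, hl, -⟩ := h N hN M hM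
    refine ⟨l, fun x hx y hy => ?_⟩
    have e := congrArg (fun T : H →ₗ[ℂ] H => ⟪x, T y⟫_ℂ) hl
    simpa only [LinearMap.comp_apply, LinearMap.smul_apply, projOf_eq C hy,
      inner_projOf_right C hx, LinearMap.adjoint_inner_right, inner_smul_right] using e
  tfae_finish
end
end
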